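/- arXiv:1501.06019 — 10 statements merged into one kernel-verified Lean document; each statement's English description precedes it below -/
import Mathlib

section
/- Fix reals V₁ > V₂ > 0 and n₁ > n₂ > 1. Let c ∈ [0,1] be a total concentration with u₁(c) = u₂(c), where u_i(φ) = V_i(1−φ)^{n_i−1}. Then for any two states Φ⁻ = (φ₁⁻, φ₂⁻) and Φ⁺ = (φ₁⁺, φ₂⁺) with φ₁⁻, φ₂⁻, φ₁⁺, φ₂⁺ ≥ 0 and φ₁⁻ + φ₂⁻ = φ₁⁺ + φ₂⁺ = c, the Rankine–Hugoniot condition f_i(Φ⁺) − f_i(Φ⁻) = σ(φ_i⁺ − φ_i⁻), i = 1,2, holds with constant speed σ = (1−c)·u₁(c). Hence the line {Φ : φ₁ + φ₂ = c} is a contact manifold: any two of its states are connected by a shock of the same speed. -/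
/-- Slip velocity `u(φ) = V (1-φ)^(n-1)` (real exponent). -/
noncomputable def slip (V n φ : ℝ) : ℝ := V * (1 - φ) ^ (n - 1)

/-- Phase velocity `w_i(Φ) = u_i(φ) - φ₁ u₁(φ) - φ₂ u₂(φ)` with `φ = φ₁ + φ₂`. -/
noncomputable def phaseVel (V₁ V₂ n₁ n₂ : ℝ) (i : Fin 2) (Φ : ℝ × ℝ) : ℝ :=
  (if i = 0 then slip V₁ n₁ (Φ.1 + Φ.2) else slip V₂ n₂ (Φ.1 + Φ.2))
    - Φ.1 * slip V₁ n₁ (Φ.1 + Φ.2) - Φ.2 * slip V₂ n₂ (Φ.1 + Φ.2)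

/-- Flux `f_i(Φ) = φ_i w_i(Φ)`. -/
noncomputable def fluxC (V₁ V₂ n₁ n₂ : ℝ) (i : Fin 2) (Φ : ℝ × ℝ) : ℝ :=
  (if i = 0 then Φ.1 else Φ.2) * phaseVel V₁ V₂ n₁ n₂ i Φ

/-- Where the slip velocities coincide, every phase is transported with velocity
`(1 - c) u₁(c)`. -/
theorem fluxC_eq_of_slip_eq {V₁ V₂ n₁ n₂ c : ℝ} (huc : slip V₁ n₁ c = slip V₂ n₂ c)
    {Φ : ℝ × ℝ} (hΦ : Φ.1 + Φ.2 = c) (i : Fin 2) :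
    fluxC V₁ V₂ n₁ n₂ i Φ = ((1 - c) * slip V₁ n₁ c) * (if i = 0 then Φ.1 else Φ.2) := by
  simp only [fluxC, phaseVel, hΦ, ← huc, ite_self]
  rw [← hΦ]
  ring

/-- On a line of constant total concentration `c` where the slip velocities coincide,
any two states are connected by a shock of constant speed `σ = (1-c) u₁(c)`:
the line `{φ₁ + φ₂ = c}` is a contact manifold. -/
theorem contact_manifold_constant_speed
    (V₁ V₂ n₁ n₂ : ℝ) (hV : V₁ > V₂) (hV2 : V₂ > 0) (hn : n₁ > n₂) (hn2 : n₂ > 1)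
    (c : ℝ) (hc : c ∈ Set.Icc (0:ℝ) 1)
    (huc : slip V₁ n₁ c = slip V₂ n₂ c)
    (Φm Φp : ℝ × ℝ)
    (hm1 : 0 ≤ Φm.1) (hm2 : 0 ≤ Φm.2) (hp1 : 0 ≤ Φp.1) (hp2 : 0 ≤ Φp.2)
    (hsm : Φm.1 + Φm.2 = c) (hsp : Φp.1 + Φp.2 = c) :
    ∀ i : Fin 2,
      fluxC V₁ V₂ n₁ n₂ i Φp - fluxC V₁ V₂ n₁ n₂ i Φm =
        ((1 - c) * slip V₁ n₁ c) *
          ((if i = 0 then Φp.1 else Φp.2) - (if i = 0 then Φm.1 else Φm.2)) := by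
  intro i
  rw [fluxC_eq_of_slip_eq huc hsp, fluxC_eq_of_slip_eq huc hsm, mul_sub]
end

section
/- Fix reals V₁ > V₂ > 0 and n₁ > n₂ > 1, and let φ* = 1 − (V₂/V₁)^{1/(n₁−n₂)}. Let Φ = (φ₁, φ₂) be a state in the phase space D with Φ ≠ (0,0). Then there exists σ ∈ ℝ with f_i(Φ) = σ·φ_i for i = 1,2 (the Rankine–Hugoniot condition with the origin) if and only if φ₂ = 0, or φ₁ = 0, or φ₁ + φ₂ = φ*, or φ₁ + φ₂ = 1. Moreover, if Φ lies on the axis φ_j = 0 (j ≠ i) then σ = w_i(Φ), while if φ₁ + φ₂ ∈ {φ*, 1} with φ₁, φ₂ > 0 then σ = w₁(Φ) = w₂(Φ). -/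
/-- The phase space `D`. -/
def phaseSpace : Set (ℝ × ℝ) := {Φ | 0 ≤ Φ.1 ∧ 0 ≤ Φ.2 ∧ Φ.1 + Φ.2 ≤ 1}

/-- Below full packing the two slip velocities agree exactly at the critical
concentration `φ*` and at `1`. -/
theorem slip_eq_slip_iff {V₁ V₂ n₁ n₂ φ : ℝ} (hV₁ : 0 < V₁) (hV₂ : 0 < V₂)
    (hn : n₂ < n₁) (hn₂ : 1 < n₂) (hφ : φ ≤ 1) :
    slip V₁ n₁ φ = slip V₂ n₂ φ ↔ φ = 1 - (V₂ / V₁) ^ (1 / (n₁ - n₂)) ∨ φ = 1 := by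
  unfold slip
  rcases hφ.eq_or_lt with rfl | hlt
  · simp [Real.zero_rpow (sub_ne_zero.2 hn₂.ne'),
      Real.zero_rpow (sub_ne_zero.2 (hn₂.trans hn).ne')]
  have hx : 0 < 1 - φ := sub_pos.2 hlt
  have hpow : (1 - φ) ^ (n₁ - 1) = (1 - φ) ^ (n₁ - n₂) * (1 - φ) ^ (n₂ - 1) := by
    rw [← Real.rpow_add hx]
    congr 1
    ring
  have hratio : V₁ * (1 - φ) ^ (n₁ - 1) = V₂ * (1 - φ) ^ (n₂ - 1) ↔
      (1 - φ) ^ (n₁ - n₂) = V₂ / V₁ := by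
    rw [hpow, ← mul_assoc, mul_left_inj' (Real.rpow_pos_of_pos hx _).ne',
      eq_div_iff hV₁.ne', mul_comm V₁]
  rw [hratio, or_iff_left hlt.ne, one_div,
    ← Real.eq_rpow_inv hx.le (div_pos hV₂ hV₁).le (sub_ne_zero.2 hn.ne')]
  constructor <;> intro h <;> linarith

/-- The phase velocities agree exactly when the slip velocities do. -/
theorem phaseVel_zero_eq_one_iff (V₁ V₂ n₁ n₂ : ℝ) (Φ : ℝ × ℝ) :
    phaseVel V₁ V₂ n₁ n₂ 0 Φ = phaseVel V₁ V₂ n₁ n₂ 1 Φ ↔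
      slip V₁ n₁ (Φ.1 + Φ.2) = slip V₂ n₂ (Φ.1 + Φ.2) := by
  simp [phaseVel]

theorem fluxC_zero (V₁ V₂ n₁ n₂ : ℝ) (Φ : ℝ × ℝ) :
    fluxC V₁ V₂ n₁ n₂ 0 Φ = phaseVel V₁ V₂ n₁ n₂ 0 Φ * Φ.1 := by
  simp [fluxC, mul_comm]

theorem fluxC_one (V₁ V₂ n₁ n₂ : ℝ) (Φ : ℝ × ℝ) :
    fluxC V₁ V₂ n₁ n₂ 1 Φ = phaseVel V₁ V₂ n₁ n₂ 1 Φ * Φ.2 := by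
  simp [fluxC, mul_comm]

/-- The Hugoniot locus of the origin consists of the two axes and the two contact
lines `{φ₁+φ₂ = φ*}` and `{φ₁+φ₂ = 1}`; with the corresponding shock speeds. -/
theorem hugoniot_locus_of_origin
    (V₁ V₂ n₁ n₂ : ℝ) (hV : V₁ > V₂) (hV2 : V₂ > 0) (hn : n₁ > n₂) (hn2 : n₂ > 1)
    (Φ : ℝ × ℝ) (hΦ : Φ ∈ phaseSpace) (hne : Φ ≠ (0, 0)) :
    ((∃ σ : ℝ, fluxC V₁ V₂ n₁ n₂ 0 Φ = σ * Φ.1 ∧ fluxC V₁ V₂ n₁ n₂ 1 Φ = σ * Φ.2) ↔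
      (Φ.2 = 0 ∨ Φ.1 = 0 ∨ Φ.1 + Φ.2 = 1 - (V₂ / V₁) ^ (1 / (n₁ - n₂)) ∨
        Φ.1 + Φ.2 = 1)) ∧
    (Φ.2 = 0 →
      fluxC V₁ V₂ n₁ n₂ 0 Φ = phaseVel V₁ V₂ n₁ n₂ 0 Φ * Φ.1 ∧
      fluxC V₁ V₂ n₁ n₂ 1 Φ = phaseVel V₁ V₂ n₁ n₂ 0 Φ * Φ.2) ∧
    (Φ.1 = 0 →
      fluxC V₁ V₂ n₁ n₂ 0 Φ = phaseVel V₁ V₂ n₁ n₂ 1 Φ * Φ.1 ∧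
      fluxC V₁ V₂ n₁ n₂ 1 Φ = phaseVel V₁ V₂ n₁ n₂ 1 Φ * Φ.2) ∧
    ((Φ.1 + Φ.2 = 1 - (V₂ / V₁) ^ (1 / (n₁ - n₂)) ∨ Φ.1 + Φ.2 = 1) →
      0 < Φ.1 → 0 < Φ.2 →
      phaseVel V₁ V₂ n₁ n₂ 0 Φ = phaseVel V₁ V₂ n₁ n₂ 1 Φ ∧
      fluxC V₁ V₂ n₁ n₂ 0 Φ = phaseVel V₁ V₂ n₁ n₂ 0 Φ * Φ.1 ∧
      fluxC V₁ V₂ n₁ n₂ 1 Φ = phaseVel V₁ V₂ n₁ n₂ 0 Φ * Φ.2) := by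
  have hw := (phaseVel_zero_eq_one_iff V₁ V₂ n₁ n₂ Φ).trans
    (slip_eq_slip_iff (hV2.trans hV) hV2 hn hn2 hΦ.2.2)
  rw [fluxC_zero, fluxC_one, ← hw]
  refine ⟨⟨?_, ?_⟩, fun h => by simp [h], fun h => by simp [h], fun h _ _ => ?_⟩
  · rintro ⟨σ, h₁, h₂⟩
    by_cases hΦ₂ : Φ.2 = 0
    · exact Or.inl hΦ₂
    by_cases hΦ₁ : Φ.1 = 0
    · exact Or.inr (Or.inl hΦ₁)
    · exact Or.inr (Or.inr ((mul_right_cancel₀ hΦ₁ h₁).trans (mul_right_cancel₀ hΦ₂ h₂).symm))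
  · rintro (h | h | h)
    · exact ⟨phaseVel V₁ V₂ n₁ n₂ 0 Φ, rfl, by simp [h]⟩
    · exact ⟨phaseVel V₁ V₂ n₁ n₂ 1 Φ, by simp [h], rfl⟩
    · exact ⟨phaseVel V₁ V₂ n₁ n₂ 0 Φ, rfl, by rw [h]⟩
  · exact ⟨h, rfl, by rw [h]⟩
end

section
/- Fix reals V₁ > V₂ > 0 and n₁ > n₂ > 1. For a state Φ = (φ₁, φ₂) with φ₁, φ₂ ≥ 0 and φ = φ₁ + φ₂ < 1, the two eigenvalues of the Jacobian matrix J(Φ) are λ_± = ½[w₁(Φ) + w₂(Φ)] − ½[n₁φ₁u₁(φ) + n₂φ₂u₂(φ)] ± ½√Δ(Φ); that is, det(J(Φ) − λ_± I) = 0 for both choices of sign, where Δ(Φ) = [(n₁φ₁ − 1)u₁(φ) − (n₂φ₂ − 1)u₂(φ)]² + 4 n₁ n₂ φ₁ φ₂ u₁(φ) u₂(φ). -/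
/-- Derivative of the slip velocity, `u'(φ) = -(n-1) V (1-φ)^(n-2)`. -/
noncomputable def slip' (V n φ : ℝ) : ℝ := -(n - 1) * V * (1 - φ) ^ (n - 2)

/-- Phase velocity `w₁(Φ) = u₁(φ) - φ₁ u₁(φ) - φ₂ u₂(φ)` with `φ = φ₁ + φ₂`. -/
noncomputable def w1 (V₁ V₂ n₁ n₂ : ℝ) (Φ : ℝ × ℝ) : ℝ :=
  slip V₁ n₁ (Φ.1 + Φ.2) - Φ.1 * slip V₁ n₁ (Φ.1 + Φ.2) - Φ.2 * slip V₂ n₂ (Φ.1 + Φ.2)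

/-- Phase velocity `w₂(Φ) = u₂(φ) - φ₁ u₁(φ) - φ₂ u₂(φ)` with `φ = φ₁ + φ₂`. -/
noncomputable def w2 (V₁ V₂ n₁ n₂ : ℝ) (Φ : ℝ × ℝ) : ℝ :=
  slip V₂ n₂ (Φ.1 + Φ.2) - Φ.1 * slip V₁ n₁ (Φ.1 + Φ.2) - Φ.2 * slip V₂ n₂ (Φ.1 + Φ.2)

/-- `u_{ij}(Φ) = u_i'(φ) - (φ₁u₁'(φ) + φ₂u₂'(φ)) - u_j(φ)`, encoded via the data
`(Vi, ni)` of species `i` and `(Vj, nj)` of species `j`. -/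
noncomputable def uij (V₁ V₂ n₁ n₂ Vi ni Vj nj : ℝ) (Φ : ℝ × ℝ) : ℝ :=
  slip' Vi ni (Φ.1 + Φ.2)
    - (Φ.1 * slip' V₁ n₁ (Φ.1 + Φ.2) + Φ.2 * slip' V₂ n₂ (Φ.1 + Φ.2))
    - slip Vj nj (Φ.1 + Φ.2)

/-- Jacobian matrix of the flux `f_i(Φ) = φ_i w_i(Φ)`. -/
noncomputable def Jac (V₁ V₂ n₁ n₂ : ℝ) (Φ : ℝ × ℝ) : Matrix (Fin 2) (Fin 2) ℝ :=
  !![w1 V₁ V₂ n₁ n₂ Φ + Φ.1 * uij V₁ V₂ n₁ n₂ V₁ n₁ V₁ n₁ Φ,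
       Φ.1 * uij V₁ V₂ n₁ n₂ V₁ n₁ V₂ n₂ Φ;
     Φ.2 * uij V₁ V₂ n₁ n₂ V₂ n₂ V₁ n₁ Φ,
       w2 V₁ V₂ n₁ n₂ Φ + Φ.2 * uij V₁ V₂ n₁ n₂ V₂ n₂ V₂ n₂ Φ]

/-- Discriminant `Δ(Φ)` of the Jacobian matrix. -/
noncomputable def disc (V₁ V₂ n₁ n₂ : ℝ) (Φ : ℝ × ℝ) : ℝ :=
  ((n₁ * Φ.1 - 1) * slip V₁ n₁ (Φ.1 + Φ.2) - (n₂ * Φ.2 - 1) * slip V₂ n₂ (Φ.1 + Φ.2)) ^ 2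
    + 4 * n₁ * n₂ * Φ.1 * Φ.2 * slip V₁ n₁ (Φ.1 + Φ.2) * slip V₂ n₂ (Φ.1 + Φ.2)

theorem slip_eq_mul_one_sub (V n : ℝ) {φ : ℝ} (hφ : φ < 1) :
    slip V n φ = V * (1 - φ) ^ (n - 2) * (1 - φ) := by
  have h : (1 - φ) ^ (n - 1) = (1 - φ) ^ (n - 2) * (1 - φ) := by
    rw [← Real.rpow_add_one (sub_pos.2 hφ).ne']
    ring_nf
  rw [slip, h, mul_assoc]

theorem disc_nonneg {V₁ V₂ n₁ n₂ : ℝ} (hV₁ : 0 ≤ V₁) (hV₂ : 0 ≤ V₂) (hn₁ : 0 ≤ n₁)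
    (hn₂ : 0 ≤ n₂) {Φ : ℝ × ℝ} (h1 : 0 ≤ Φ.1) (h2 : 0 ≤ Φ.2) (hs : Φ.1 + Φ.2 ≤ 1) :
    0 ≤ disc V₁ V₂ n₁ n₂ Φ := by
  have hφ : 0 ≤ 1 - (Φ.1 + Φ.2) := sub_nonneg.2 hs
  have hu₁ : 0 ≤ slip V₁ n₁ (Φ.1 + Φ.2) := mul_nonneg hV₁ (Real.rpow_nonneg hφ _)
  have hu₂ : 0 ≤ slip V₂ n₂ (Φ.1 + Φ.2) := mul_nonneg hV₂ (Real.rpow_nonneg hφ _)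
  unfold disc
  positivity

/-- Any square root `r` of the discriminant yields a root of the characteristic polynomial. -/
theorem det_Jac_sub_smul_one_eq_zero (V₁ V₂ n₁ n₂ : ℝ) {Φ : ℝ × ℝ} (hs : Φ.1 + Φ.2 < 1)
    {r : ℝ} (hr : r ^ 2 = disc V₁ V₂ n₁ n₂ Φ) :
    Matrix.det (Jac V₁ V₂ n₁ n₂ Φ
        - ((w1 V₁ V₂ n₁ n₂ Φ + w2 V₁ V₂ n₁ n₂ Φ) / 2
            - (n₁ * Φ.1 * slip V₁ n₁ (Φ.1 + Φ.2) + n₂ * Φ.2 * slip V₂ n₂ (Φ.1 + Φ.2)) / 2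
            + r / 2) • (1 : Matrix (Fin 2) (Fin 2) ℝ)) = 0 := by
  rw [Matrix.det_fin_two]
  simp only [Jac, disc, w1, w2, uij, slip', slip_eq_mul_one_sub _ _ hs, Matrix.sub_apply,
    Matrix.smul_apply, Matrix.one_apply_eq, Matrix.of_apply, Matrix.cons_val', Matrix.cons_val_zero,
    Matrix.cons_val_one, Matrix.cons_val_fin_one, smul_eq_mul, mul_one,
    Matrix.one_apply_ne zero_ne_one, Matrix.one_apply_ne one_ne_zero, mul_zero, sub_zero] at hr ⊢
  generalize (1 - (Φ.1 + Φ.2)) ^ (n₁ - 2) = p at hr ⊢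
  generalize (1 - (Φ.1 + Φ.2)) ^ (n₂ - 2) = q at hr ⊢
  linear_combination hr / 4

/-- The eigenvalues of the Jacobian matrix are
`λ_± = ½(w₁+w₂) - ½(n₁φ₁u₁ + n₂φ₂u₂) ± ½√Δ`. -/
theorem jacobian_eigenvalues
    (V₁ V₂ n₁ n₂ : ℝ) (hV : V₁ > V₂) (hV2 : V₂ > 0) (hn : n₁ > n₂) (hn2 : n₂ > 1)
    (Φ : ℝ × ℝ) (h1 : 0 ≤ Φ.1) (h2 : 0 ≤ Φ.2) (hs : Φ.1 + Φ.2 < 1) :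
    Matrix.det (Jac V₁ V₂ n₁ n₂ Φ
        - ((w1 V₁ V₂ n₁ n₂ Φ + w2 V₁ V₂ n₁ n₂ Φ) / 2
            - (n₁ * Φ.1 * slip V₁ n₁ (Φ.1 + Φ.2) + n₂ * Φ.2 * slip V₂ n₂ (Φ.1 + Φ.2)) / 2
            + Real.sqrt (disc V₁ V₂ n₁ n₂ Φ) / 2) • (1 : Matrix (Fin 2) (Fin 2) ℝ)) = 0 ∧
    Matrix.det (Jac V₁ V₂ n₁ n₂ Φ
        - ((w1 V₁ V₂ n₁ n₂ Φ + w2 V₁ V₂ n₁ n₂ Φ) / 2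
            - (n₁ * Φ.1 * slip V₁ n₁ (Φ.1 + Φ.2) + n₂ * Φ.2 * slip V₂ n₂ (Φ.1 + Φ.2)) / 2
            - Real.sqrt (disc V₁ V₂ n₁ n₂ Φ) / 2) • (1 : Matrix (Fin 2) (Fin 2) ℝ)) = 0 := by
  have hr := Real.sq_sqrt (disc_nonneg (hV2.trans hV).le hV2.le (by linarith) (by linarith)
    h1 h2 hs.le : 0 ≤ disc V₁ V₂ n₁ n₂ Φ)
  refine ⟨det_Jac_sub_smul_one_eq_zero V₁ V₂ n₁ n₂ hs hr, ?_⟩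
  have h := det_Jac_sub_smul_one_eq_zero V₁ V₂ n₁ n₂ hs ((neg_sq _).trans hr)
  rwa [neg_div, ← sub_eq_add_neg] at h
end

section
/- Fix reals V₁ > V₂ > 0 and n₁ > n₂ > 1. Let Φ = (φ₁, φ₂) with φ₁, φ₂ ≥ 0 and total concentration φ = φ₁ + φ₂ < 1 satisfying u₁(φ) = u₂(φ). Then the eigenvalues of the Jacobian matrix J(Φ) are λ₂ = w₁(Φ) = (1−φ)u₁(φ) and λ₁ = w₁(Φ) − √Δ(Φ); that is, det(J(Φ) − w₁(Φ)·I) = 0 and det(J(Φ) − (w₁(Φ) − √Δ(Φ))·I) = 0, with λ₁ ≤ λ₂. In particular, along the line {φ₁ + φ₂ = φ} the second eigenvalue is constant and equal to the shock speed (1−φ)u₁(φ), so this line is a contact manifold of the second characteristic family. -/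
/-- Euler-type relation `(1 - φ) u'(φ) = -(n - 1) u(φ)`. -/
theorem one_sub_mul_slip' (V n : ℝ) {φ : ℝ} (h : φ < 1) :
    (1 - φ) * slip' V n φ = -(n - 1) * slip V n φ := by
  have hpos : 0 < 1 - φ := sub_pos.2 h
  have hpow : (1 - φ) ^ (n - 1) = (1 - φ) ^ (n - 2) * (1 - φ) := by
    rw [← Real.rpow_add_one hpos.ne']
    ring_nf
  rw [slip, slip', hpow]
  ring

theorem slip_nonneg {V φ : ℝ} (n : ℝ) (hV : 0 ≤ V) (h : φ ≤ 1) : 0 ≤ slip V n φ :=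
  mul_nonneg hV (Real.rpow_nonneg (sub_nonneg.2 h) _)

/-- At equal slip velocities the discriminant is a perfect square. -/
theorem sqrt_disc_of_slip_eq {V₁ V₂ n₁ n₂ : ℝ} (hV₂ : 0 ≤ V₂) (hn₁ : 0 ≤ n₁) (hn₂ : 0 ≤ n₂)
    {Φ : ℝ × ℝ} (h1 : 0 ≤ Φ.1) (h2 : 0 ≤ Φ.2) (hs : Φ.1 + Φ.2 ≤ 1)
    (hu : slip V₁ n₁ (Φ.1 + Φ.2) = slip V₂ n₂ (Φ.1 + Φ.2)) :
    Real.sqrt (disc V₁ V₂ n₁ n₂ Φ) = (n₁ * Φ.1 + n₂ * Φ.2) * slip V₂ n₂ (Φ.1 + Φ.2) := by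
  have hslip := slip_nonneg n₂ hV₂ hs
  rw [show disc V₁ V₂ n₁ n₂ Φ = ((n₁ * Φ.1 + n₂ * Φ.2) * slip V₂ n₂ (Φ.1 + Φ.2)) ^ 2 by
    rw [disc, hu]; ring]
  exact Real.sqrt_sq (by positivity)

/-- On a line of equal slip velocities the eigenvalues of the Jacobian are
`λ₂ = w₁(Φ) = (1-φ)u₁(φ)` and `λ₁ = w₁(Φ) - √Δ(Φ)`, with `λ₁ ≤ λ₂`; the second
eigenvalue is constant along the line, which is hence a contact manifold of the
second characteristic family. -/
theorem eigenvalues_on_contact_manifold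
    (V₁ V₂ n₁ n₂ : ℝ) (hV : V₁ > V₂) (hV2 : V₂ > 0) (hn : n₁ > n₂) (hn2 : n₂ > 1)
    (Φ : ℝ × ℝ) (h1 : 0 ≤ Φ.1) (h2 : 0 ≤ Φ.2) (hs : Φ.1 + Φ.2 < 1)
    (hu : slip V₁ n₁ (Φ.1 + Φ.2) = slip V₂ n₂ (Φ.1 + Φ.2)) :
    w1 V₁ V₂ n₁ n₂ Φ = (1 - (Φ.1 + Φ.2)) * slip V₁ n₁ (Φ.1 + Φ.2) ∧
    Matrix.det (Jac V₁ V₂ n₁ n₂ Φ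
        - (w1 V₁ V₂ n₁ n₂ Φ) • (1 : Matrix (Fin 2) (Fin 2) ℝ)) = 0 ∧
    Matrix.det (Jac V₁ V₂ n₁ n₂ Φ
        - (w1 V₁ V₂ n₁ n₂ Φ - Real.sqrt (disc V₁ V₂ n₁ n₂ Φ))
          • (1 : Matrix (Fin 2) (Fin 2) ℝ)) = 0 ∧
    w1 V₁ V₂ n₁ n₂ Φ - Real.sqrt (disc V₁ V₂ n₁ n₂ Φ) ≤ w1 V₁ V₂ n₁ n₂ Φ := by
  have e₁ := one_sub_mul_slip' V₁ n₁ hs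
  have e₂ := one_sub_mul_slip' V₂ n₂ hs
  rw [hu] at e₁
  refine ⟨?_, ?_, ?_, sub_le_self _ (Real.sqrt_nonneg _)⟩
  · rw [w1, hu]
    ring
  · simp [Matrix.det_fin_two, Jac, w1, w2, uij, hu]
  · rw [sqrt_disc_of_slip_eq hV2.le (by linarith) (by linarith) h1 h2 hs.le hu]
    simp [Matrix.det_fin_two, Jac, w1, w2, uij, hu]
    linear_combination
      (n₁ * Φ.1 + n₂ * Φ.2) * slip V₂ n₂ (Φ.1 + Φ.2) * (Φ.1 * e₁ + Φ.2 * e₂)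
end

section
/- Fix reals V₁ > V₂ > 0 and n₁ > n₂ > 1, and fix i ∈ {1,2}. Set φ_inf = 2/(1+n_i). Then φ_inf ∈ (0,1); the derivative of the axis eigenvalue λ_a(φ) = (1 − (1+n_i)φ)·V_i(1−φ)^{n_i−1} is λ_a′(φ) = n_i((1+n_i)φ − 2)·u_i(φ)/(1−φ) for φ ∈ [0,1), so λ_a′(φ_inf) = 0; and at the inflection state (with φ_i = φ_inf and φ_{3−i} = 0) one has λ_a(φ_inf) < λ_b(φ_inf), where λ_b(φ) = u_{3−i}(φ) − φ u_i(φ). Hence the inflection point on each axis belongs to the first (slower) characteristic family. -/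
theorem slip_pos {V n φ : ℝ} (hV : 0 < V) (hφ : φ < 1) : 0 < slip V n φ :=
  mul_pos hV (Real.rpow_pos_of_pos (sub_pos.2 hφ) _)

theorem hasDerivAt_slip (V n : ℝ) {φ : ℝ} (hφ : φ < 1) :
    HasDerivAt (slip V n) (-(n - 1) * slip V n φ / (1 - φ)) φ := by
  have h : 0 < 1 - φ := sub_pos.2 hφ
  have hd := (((hasDerivAt_id φ).const_sub 1).rpow_const (p := n - 1) (Or.inl h.ne')).const_mul V
  refine hd.congr_deriv ?_
  simp only [id, slip, Real.rpow_sub_one h.ne' (n - 1)]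
  ring

/-- Derivative of the axis eigenvalue `(1-(1+n)φ)u(φ)`. -/
theorem hasDerivAt_axis_eigenvalue (V n : ℝ) {φ : ℝ} (hφ : φ < 1) :
    HasDerivAt (fun s => (1 - (1 + n) * s) * slip V n s)
      (n * ((1 + n) * φ - 2) * slip V n φ / (1 - φ)) φ := by
  have h : 1 - φ ≠ 0 := (sub_pos.2 hφ).ne'
  refine ((((hasDerivAt_id φ).const_mul (1 + n)).const_sub 1).mul
    (hasDerivAt_slip V n hφ)).congr_deriv ?_
  simp only [id]
  field_simp
  ring

/-- On each axis (species `i` with data `(Vi, ni)`, complementary species with data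
`(Vj, nj)`) the eigenvalue `λ_a(φ) = (1-(1+n_i)φ)u_i(φ)` has derivative
`n_i((1+n_i)φ-2)u_i(φ)/(1-φ)` on `[0,1)`, which vanishes at the inflection point
`φ_inf = 2/(1+n_i) ∈ (0,1)`, where moreover `λ_a(φ_inf) < λ_b(φ_inf)`:
the inflection point belongs to the first (slower) characteristic family. -/
theorem inflection_point_first_family
    (V₁ V₂ n₁ n₂ : ℝ) (hV : V₁ > V₂) (hV2 : V₂ > 0) (hn : n₁ > n₂) (hn2 : n₂ > 1)
    (Vi ni Vj nj : ℝ)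
    (hi : (Vi = V₁ ∧ ni = n₁ ∧ Vj = V₂ ∧ nj = n₂) ∨
          (Vi = V₂ ∧ ni = n₂ ∧ Vj = V₁ ∧ nj = n₁)) :
    (2 / (1 + ni) ∈ Set.Ioo (0:ℝ) 1) ∧
    (∀ φ ∈ Set.Ico (0:ℝ) 1,
      HasDerivAt (fun s => (1 - (1 + ni) * s) * slip Vi ni s)
        (ni * ((1 + ni) * φ - 2) * slip Vi ni φ / (1 - φ)) φ) ∧
    HasDerivAt (fun s => (1 - (1 + ni) * s) * slip Vi ni s) 0 (2 / (1 + ni)) ∧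
    (1 - (1 + ni) * (2 / (1 + ni))) * slip Vi ni (2 / (1 + ni))
      < slip Vj nj (2 / (1 + ni)) - (2 / (1 + ni)) * slip Vi ni (2 / (1 + ni)) := by
  have hn_i : 1 < ni := by rcases hi with ⟨-, rfl, -, -⟩ | ⟨-, rfl, -, -⟩ <;> linarith
  have hVi : 0 < Vi := by rcases hi with ⟨rfl, -, -, -⟩ | ⟨rfl, -, -, -⟩ <;> linarith
  have hVj : 0 < Vj := by rcases hi with ⟨-, -, rfl, -⟩ | ⟨-, -, rfl, -⟩ <;> linarith
  have hpos : 0 < 1 + ni := by linarith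
  have hmul : (1 + ni) * (2 / (1 + ni)) = 2 := mul_div_cancel₀ 2 hpos.ne'
  have hlt : 2 / (1 + ni) < 1 := (div_lt_one hpos).2 (by linarith)
  refine ⟨⟨by positivity, hlt⟩, fun φ hφ => hasDerivAt_axis_eigenvalue Vi ni hφ.2, ?_, ?_⟩
  · refine (hasDerivAt_axis_eigenvalue Vi ni hlt).congr_deriv ?_
    simp [hmul]
  · rw [hmul]
    linarith [slip_pos (n := nj) hVj hlt, mul_pos (sub_pos.2 hlt) (slip_pos (n := ni) hVi hlt)]
end

section
/- Fix reals V₁ > V₂ > 0 and n₁ > n₂ > 1. There exists a unique φᵘ ∈ [0,1] such that (1 − n₁φᵘ)(1 − φᵘ)^{n₁−n₂} = V₂/V₁; moreover φᵘ ∈ (0, 1/n₁). At the state Q₁ = (φᵘ, 0) the two eigenvalues of the Jacobian on the first axis coincide: (1 − (1+n₁)φᵘ)·u₁(φᵘ) = u₂(φᵘ) − φᵘ·u₁(φᵘ), equivalently (1 − n₁φᵘ)u₁(φᵘ) = u₂(φᵘ). Hence Q₁ is the unique coincidence point of characteristic speeds on the first axis. -/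
/-- Any two points of `(-∞, 1]` at which `(1 - a x) (1 - x) ^ b` takes the same positive value
are equal. -/
theorem eq_of_one_sub_mul_rpow_eq {a b c x y : ℝ} (ha : 0 < a) (hb : 0 < b) (hc : 0 < c)
    (hx : x ≤ 1) (hy : y ≤ 1)
    (hxc : (1 - a * x) * (1 - x) ^ b = c) (hyc : (1 - a * y) * (1 - y) ^ b = c) : x = y := by
  have not_lt : ∀ s t : ℝ, s ≤ 1 → t ≤ 1 → (1 - a * s) * (1 - s) ^ b = c →
      (1 - a * t) * (1 - t) ^ b = c → ¬ s < t := by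
    intro s t hs ht hsc htc hst
    have hpow : 0 ≤ (1 - t) ^ b := Real.rpow_nonneg (by linarith) b
    have hfac : 0 < 1 - a * t := pos_of_mul_pos_left (htc ▸ hc) hpow
    have hlin : 1 - a * t < 1 - a * s := by nlinarith
    have hmono : (1 - t) ^ b < (1 - s) ^ b :=
      Real.rpow_lt_rpow (by linarith) (by linarith) hb
    have := mul_lt_mul'' hlin hmono hfac.le hpow
    linarith
  exact le_antisymm (le_of_not_gt (not_lt y x hy hx hyc hxc))
    (le_of_not_gt (not_lt x y hx hy hxc hyc))

/-- There is a unique `φᵘ ∈ [0,1]` with `(1-n₁φᵘ)(1-φᵘ)^(n₁-n₂) = V₂/V₁`; it lies in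
`(0, 1/n₁)` and at `Q₁ = (φᵘ, 0)` the two eigenvalues on the first axis coincide:
`(1-(1+n₁)φᵘ)u₁(φᵘ) = u₂(φᵘ) - φᵘ u₁(φᵘ)`, equivalently `(1-n₁φᵘ)u₁(φᵘ) = u₂(φᵘ)`. -/
theorem unique_coincidence_point_first_axis
    (V₁ V₂ n₁ n₂ : ℝ) (hV : V₁ > V₂) (hV2 : V₂ > 0) (hn : n₁ > n₂) (hn2 : n₂ > 1) :
    (∃! φu : ℝ, φu ∈ Set.Icc (0:ℝ) 1 ∧
      (1 - n₁ * φu) * (1 - φu) ^ (n₁ - n₂) = V₂ / V₁) ∧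
    (∀ φu : ℝ, φu ∈ Set.Icc (0:ℝ) 1 →
      (1 - n₁ * φu) * (1 - φu) ^ (n₁ - n₂) = V₂ / V₁ →
      φu ∈ Set.Ioo (0:ℝ) (1 / n₁) ∧
      (1 - (1 + n₁) * φu) * slip V₁ n₁ φu = slip V₂ n₂ φu - φu * slip V₁ n₁ φu ∧
      (1 - n₁ * φu) * slip V₁ n₁ φu = slip V₂ n₂ φu) := by
  have hV1 : 0 < V₁ := hV2.trans hV
  have hn1 : 0 < n₁ := by linarith
  have hb : 0 < n₁ - n₂ := sub_pos.2 hn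
  have hc : 0 < V₂ / V₁ := div_pos hV2 hV1
  have hc1 : V₂ / V₁ < 1 := (div_lt_one hV1).2 hV
  refine ⟨?_, ?_⟩
  · have hcont : Continuous fun x : ℝ => (1 - n₁ * x) * (1 - x) ^ (n₁ - n₂) :=
      (by fun_prop : Continuous fun x : ℝ => 1 - n₁ * x).mul
        ((by fun_prop : Continuous fun x : ℝ => 1 - x).rpow_const fun _ => Or.inr hb.le)
    obtain ⟨x, hx, hxc⟩ := intermediate_value_Icc' zero_le_one hcont.continuousOn
      (show V₂ / V₁ ∈ Set.Icc _ _ by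
        simp only [sub_self, Real.zero_rpow hb.ne', mul_zero, sub_zero, Real.one_rpow, mul_one]
        exact ⟨hc.le, hc1.le⟩)
    exact ⟨x, ⟨hx, hxc⟩, fun y hy => eq_of_one_sub_mul_rpow_eq hn1 hb hc hy.1.2 hx.2 hy.2 hxc⟩
  · intro x hx hxc
    have hx0 : x ≠ 0 := by
      rintro rfl
      simp only [mul_zero, sub_zero, Real.one_rpow, mul_one] at hxc
      linarith
    have hx1 : x ≠ 1 := by
      rintro rfl
      simp only [sub_self, Real.zero_rpow hb.ne', mul_zero] at hxc
      linarith
    have hpos : 0 < 1 - x := sub_pos.2 (lt_of_le_of_ne hx.2 hx1)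
    have hfac : 0 < 1 - n₁ * x :=
      pos_of_mul_pos_left (hxc ▸ hc) (Real.rpow_nonneg hpos.le _)
    have hcoin : (1 - n₁ * x) * slip V₁ n₁ x = slip V₂ n₂ x := by
      have hsplit : (1 - x) ^ (n₁ - 1) = (1 - x) ^ (n₁ - n₂) * (1 - x) ^ (n₂ - 1) := by
        rw [← Real.rpow_add hpos]
        ring_nf
      rw [eq_div_iff hV1.ne'] at hxc
      rw [slip, slip, hsplit, ← hxc]
      ring
    refine ⟨⟨lt_of_le_of_ne hx.1 hx0.symm, ?_⟩, ?_, hcoin⟩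
    · rw [lt_div_iff₀ hn1]
      linarith
    · linear_combination hcoin
end

section
/- Fix reals V₁ > V₂ > 0 and n₁ > n₂ > 1 satisfying additionally n₂ + 1 < n₁ < 2n₂. Then for every φ ∈ [0, 1) one has (1 − n₂φ)(1 − φ)^{n₂−n₁} < V₁/V₂; equivalently, on the second axis ∂² the two eigenvalues (1 − (1+n₂)φ)u₂(φ) and u₁(φ) − φu₂(φ) never coincide for φ ∈ [0,1), so there is no coincidence point on ∂². -/
/-- Under the additional assumption `n₂ + 1 < n₁ < 2n₂` there is no coincidence point
on the second axis: `(1-n₂φ)(1-φ)^(n₂-n₁) < V₁/V₂` for all `φ ∈ [0,1)`, equivalently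
the two axis eigenvalues never coincide there. -/
theorem no_coincidence_point_second_axis
    (V₁ V₂ n₁ n₂ : ℝ) (hV : V₁ > V₂) (hV2 : V₂ > 0) (hn : n₁ > n₂) (hn2 : n₂ > 1)
    (hlo : n₂ + 1 < n₁) (hhi : n₁ < 2 * n₂) :
    ∀ φ ∈ Set.Ico (0:ℝ) 1,
      (1 - n₂ * φ) * (1 - φ) ^ (n₂ - n₁) < V₁ / V₂ ∧
      (1 - (1 + n₂) * φ) * slip V₂ n₂ φ ≠ slip V₁ n₁ φ - φ * slip V₂ n₂ φ := by
  rintro φ ⟨hφ0, hφ1⟩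
  have hs : 0 < 1 - φ := by linarith
  have hbern : 1 - n₂ * φ ≤ (1 - φ) ^ n₂ := by
    have h := one_add_mul_self_le_rpow_one_add (s := -φ) (by linarith) hn2.le
    rwa [mul_neg, ← sub_eq_add_neg, ← sub_eq_add_neg] at h
  have hlt : (1 - n₂ * φ) * (1 - φ) ^ (n₂ - n₁) < V₁ / V₂ := by
    calc (1 - n₂ * φ) * (1 - φ) ^ (n₂ - n₁)
        ≤ (1 - φ) ^ n₂ * (1 - φ) ^ (n₂ - n₁) :=
          mul_le_mul_of_nonneg_right hbern (Real.rpow_nonneg hs.le _)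
      _ = (1 - φ) ^ (n₂ + (n₂ - n₁)) := (Real.rpow_add hs _ _).symm
      _ ≤ 1 := Real.rpow_le_one hs.le (by linarith) (by linarith)
      _ < V₁ / V₂ := (one_lt_div hV2).2 hV
  refine ⟨hlt, fun heq => hlt.ne ?_⟩
  have hsplit : (1 - φ) ^ (n₂ - 1) = (1 - φ) ^ (n₁ - 1) * (1 - φ) ^ (n₂ - n₁) := by
    rw [← Real.rpow_add hs]
    ring_nf
  have hpos : 0 < (1 - φ) ^ (n₁ - 1) := Real.rpow_pos_of_pos hs _
  unfold slip at heq
  rw [hsplit] at heq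
  rw [eq_div_iff hV2.ne']
  apply mul_left_cancel₀ hpos.ne'
  linear_combination heq
end

section
/- Fix reals V₁ > V₂ > 0 and n₁ > n₂ > 1. Set φ^σ = 1 − (V₂/V₁)^{1/n₁} and φ* = 1 − (V₂/V₁)^{1/(n₁−n₂)}. Then 0 < φ^σ < φ* < 1, and for every φ₁ ∈ (0, φ^σ), the shock from the origin O = (0,0) to Φ = (φ₁, 0), which has speed σ = V₁(1−φ₁)^{n₁}, is a (non-characteristic) 2-Lax shock: λ_a(Φ) < σ, λ_b(Φ) < σ, and V₂ < σ < V₁, where λ_a(Φ) = (1 − (1+n₁)φ₁)u₁(φ₁), λ_b(Φ) = u₂(φ₁) − φ₁u₁(φ₁), and V₂ = λ₁(O), V₁ = λ₂(O) are the eigenvalues at the origin. -/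
/-- With `φ^σ = 1 - (V₂/V₁)^(1/n₁)` and `φ* = 1 - (V₂/V₁)^(1/(n₁-n₂))` one has
`0 < φ^σ < φ* < 1`, and for `φ₁ ∈ (0, φ^σ)` the shock from the origin to `(φ₁,0)`,
of speed `σ = V₁(1-φ₁)^(n₁)`, is a non-characteristic 2-Lax shock:
`λ_a < σ`, `λ_b < σ` and `V₂ < σ < V₁`. -/
theorem two_lax_shocks_on_first_axis
    (V₁ V₂ n₁ n₂ : ℝ) (hV : V₁ > V₂) (hV2 : V₂ > 0) (hn : n₁ > n₂) (hn2 : n₂ > 1) :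
    (0 < 1 - (V₂ / V₁) ^ (1 / n₁)) ∧
    (1 - (V₂ / V₁) ^ (1 / n₁) < 1 - (V₂ / V₁) ^ (1 / (n₁ - n₂))) ∧
    (1 - (V₂ / V₁) ^ (1 / (n₁ - n₂)) < 1) ∧
    (∀ φ₁ ∈ Set.Ioo (0:ℝ) (1 - (V₂ / V₁) ^ (1 / n₁)),
      (1 - (1 + n₁) * φ₁) * slip V₁ n₁ φ₁ < V₁ * (1 - φ₁) ^ n₁ ∧
      slip V₂ n₂ φ₁ - φ₁ * slip V₁ n₁ φ₁ < V₁ * (1 - φ₁) ^ n₁ ∧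
      V₂ < V₁ * (1 - φ₁) ^ n₁ ∧
      V₁ * (1 - φ₁) ^ n₁ < V₁) := by
  have hV1 : 0 < V₁ := hV2.trans hV
  have hn1 : 0 < n₁ := by linarith
  have hr0 : 0 < V₂ / V₁ := div_pos hV2 hV1
  have hr1 : V₂ / V₁ < 1 := (div_lt_one hV1).2 hV
  refine ⟨?_, ?_, ?_, ?_⟩
  · have := Real.rpow_lt_one hr0.le hr1 (one_div_pos.2 hn1)
    linarith
  · have := Real.rpow_lt_rpow_of_exponent_gt hr0 hr1
      (one_div_lt_one_div_of_lt (show 0 < n₁ - n₂ by linarith) (show n₁ - n₂ < n₁ by linarith))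
    linarith
  · have := Real.rpow_pos_of_pos hr0 (1 / (n₁ - n₂))
    linarith
  · rintro φ ⟨hφ0, hφ1⟩
    have hx : (V₂ / V₁) ^ (1 / n₁) < 1 - φ := by linarith
    have hx0 : 0 < 1 - φ := (Real.rpow_pos_of_pos hr0 _).trans hx
    have hx1 : 1 - φ < 1 := by linarith
    have hp : 0 < (1 - φ) ^ (n₁ - 1) := Real.rpow_pos_of_pos hx0 _
    have hq : 0 < (1 - φ) ^ (n₂ - 1) := Real.rpow_pos_of_pos hx0 _
    have hmul : (1 - φ) ^ n₁ = (1 - φ) * (1 - φ) ^ (n₁ - 1) := by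
      rw [← Real.rpow_one_add' hx0.le (by linarith)]
      congr 1
      ring
    have hr : V₂ / V₁ < (1 - φ) ^ n₁ := by
      have := Real.rpow_lt_rpow (Real.rpow_nonneg hr0.le _) hx hn1
      rwa [← Real.rpow_mul hr0.le, one_div_mul_cancel hn1.ne', Real.rpow_one] at this
    have hσ : V₂ < V₁ * (1 - φ) ^ n₁ := (div_lt_iff₀' hV1).1 hr
    have hslip : V₂ * (1 - φ) ^ (n₂ - 1) < V₁ * (1 - φ) ^ (n₁ - 1) := by
      calc V₂ * (1 - φ) ^ (n₂ - 1)
          < V₁ * (1 - φ) ^ n₁ * (1 - φ) ^ (n₂ - 1) := mul_lt_mul_of_pos_right hσ hq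
        _ = V₁ * (1 - φ) ^ (n₁ + (n₂ - 1)) := by rw [Real.rpow_add hx0, mul_assoc]
        _ < V₁ * (1 - φ) ^ (n₁ - 1) := mul_lt_mul_of_pos_left
            (Real.rpow_lt_rpow_of_exponent_gt hx0 hx1 (by linarith)) hV1
    refine ⟨?_, ?_, hσ, mul_lt_of_lt_one_right hV1 (Real.rpow_lt_one hx0.le hx1 hn1)⟩
    · have : 0 < n₁ * φ * (V₁ * (1 - φ) ^ (n₁ - 1)) := by positivity
      rw [hmul, slip]
      linarith
    · rw [hmul, slip, slip]
      linarith
end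

section
/- Fix reals V₁ > V₂ > 0 and n₁ > n₂ > 1. Set φ^σ = 1 − (V₂/V₁)^{1/n₁} and φ* = 1 − (V₂/V₁)^{1/(n₁−n₂)}. Then for every φ₁ ∈ (φ^σ, φ*), the shock from the origin O = (0,0) to Φ = (φ₁, 0), with speed σ = V₁(1−φ₁)^{n₁}, is over-compressive: λ_a(Φ) < σ, λ_b(Φ) < σ, and σ < V₂ < V₁, where λ_a(Φ) = (1 − (1+n₁)φ₁)u₁(φ₁) and λ_b(Φ) = u₂(φ₁) − φ₁u₁(φ₁). -/
/-- For `φ₁` between `φ^σ = 1 - (V₂/V₁)^(1/n₁)` and `φ* = 1 - (V₂/V₁)^(1/(n₁-n₂))`,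
the shock from the origin to `(φ₁,0)`, of speed `σ = V₁(1-φ₁)^(n₁)`, is
over-compressive: `λ_a < σ`, `λ_b < σ` and `σ < V₂ < V₁`. -/
theorem overcompressive_shocks_on_first_axis
    (V₁ V₂ n₁ n₂ : ℝ) (hV : V₁ > V₂) (hV2 : V₂ > 0) (hn : n₁ > n₂) (hn2 : n₂ > 1) :
    ∀ φ₁ ∈ Set.Ioo (1 - (V₂ / V₁) ^ (1 / n₁)) (1 - (V₂ / V₁) ^ (1 / (n₁ - n₂))),
      (1 - (1 + n₁) * φ₁) * slip V₁ n₁ φ₁ < V₁ * (1 - φ₁) ^ n₁ ∧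
      slip V₂ n₂ φ₁ - φ₁ * slip V₁ n₁ φ₁ < V₁ * (1 - φ₁) ^ n₁ ∧
      V₁ * (1 - φ₁) ^ n₁ < V₂ ∧
      V₂ < V₁ := by
  rintro φ ⟨hlo, hhi⟩
  have hV1 : 0 < V₁ := hV2.trans hV
  have hn1 : 0 < n₁ := by linarith
  have hd : 0 < n₁ - n₂ := sub_pos.2 hn
  have hr : 0 < V₂ / V₁ := div_pos hV2 hV1
  have hr1 : V₂ / V₁ < 1 := (div_lt_one hV1).2 hV
  obtain ⟨x, rfl⟩ : ∃ x, φ = 1 - x := ⟨1 - φ, by ring⟩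
  have hx_lt : x < (V₂ / V₁) ^ (1 / n₁) := by linarith
  have hx_gt : (V₂ / V₁) ^ (1 / (n₁ - n₂)) < x := by linarith
  have hx : 0 < x := (Real.rpow_pos_of_pos hr _).trans hx_gt
  have hx1 : x < 1 := hx_lt.trans (Real.rpow_lt_one hr.le hr1 (one_div_pos.2 hn1))
  have hpow : x ^ n₁ < V₂ / V₁ := by
    rw [one_div] at hx_lt
    exact (Real.lt_rpow_inv_iff_of_pos hx.le hr.le hn1).1 hx_lt
  have hpow_sub : V₂ / V₁ < x ^ (n₁ - n₂) := by
    rw [one_div] at hx_gt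
    exact (Real.rpow_inv_lt_iff_of_pos hr.le hx.le hd).1 hx_gt
  have hsplit : x ^ n₁ = x ^ (n₁ - 1) * x := by
    rw [← Real.rpow_add_one hx.ne', sub_add_cancel]
  have hslip : V₂ * x ^ (n₂ - 1) < V₁ * x ^ (n₁ - 1) := by
    have hexp : x ^ (n₁ - 1) = x ^ (n₁ - n₂) * x ^ (n₂ - 1) := by
      rw [← Real.rpow_add hx, sub_add_sub_cancel]
    rw [hexp, ← mul_assoc]
    exact mul_lt_mul_of_pos_right ((div_lt_iff₀' hV1).1 hpow_sub) (Real.rpow_pos_of_pos hx _)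
  simp only [slip, sub_sub_cancel]
  refine ⟨?_, ?_, (lt_div_iff₀' hV1).1 hpow, hV⟩
  · have hpos : 0 < n₁ * (1 - x) * (V₁ * x ^ (n₁ - 1)) :=
      mul_pos (mul_pos hn1 (sub_pos.2 hx1)) (mul_pos hV1 (Real.rpow_pos_of_pos hx _))
    rw [hsplit]
    linarith
  · rw [hsplit]
    linarith
end

section
/- Fix reals V₁ > V₂ > 0 and n₁ > n₂ > 1, and set φ* = 1 − (V₂/V₁)^{1/(n₁−n₂)}. Then for every φ₁ ∈ (φ*, 1), the shock from the origin O = (0,0) to Φ = (φ₁, 0), with speed σ = V₁(1−φ₁)^{n₁}, is a 1-Lax shock: λ_a(Φ) < σ < λ_b(Φ) and σ < V₂ < V₁, where λ_a(Φ) = (1 − (1+n₁)φ₁)u₁(φ₁) and λ_b(Φ) = u₂(φ₁) − φ₁u₁(φ₁); moreover at φ₁ = φ* the shock is right-characteristic: σ = λ_b(Φ). -/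
/-- On `φ < 1` the Rankine–Hugoniot speed is `(1 - φ)` times the slip velocity. -/
lemma mul_rpow_eq_one_sub_mul_slip {φ : ℝ} (hφ : φ < 1) (V n : ℝ) :
    V * (1 - φ) ^ n = (1 - φ) * slip V n φ := by
  have h0 : 0 < 1 - φ := sub_pos.2 hφ
  rw [slip, Real.rpow_sub_one h0.ne']
  field_simp

/-- Splitting off the power `(1 - φ) ^ (n₁ - n₂)` from the slip velocity. -/
lemma slip_eq_mul_rpow {φ : ℝ} (hφ : φ < 1) (V n₁ n₂ : ℝ) :
    slip V n₁ φ = V * (1 - φ) ^ (n₁ - n₂) * (1 - φ) ^ (n₂ - 1) := by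
  rw [slip, mul_assoc, ← Real.rpow_add (sub_pos.2 hφ), sub_add_sub_cancel]

/-- For `φ₁ ∈ (φ*, 1)` with `φ* = 1 - (V₂/V₁)^(1/(n₁-n₂))`, the shock from the origin
to `(φ₁,0)`, of speed `σ = V₁(1-φ₁)^(n₁)`, is a 1-Lax shock: `λ_a < σ < λ_b` and
`σ < V₂ < V₁`; at `φ₁ = φ*` the shock is right-characteristic: `σ = λ_b`. -/
theorem one_lax_shocks_on_first_axis
    (V₁ V₂ n₁ n₂ : ℝ) (hV : V₁ > V₂) (hV2 : V₂ > 0) (hn : n₁ > n₂) (hn2 : n₂ > 1) :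
    (∀ φ₁ ∈ Set.Ioo (1 - (V₂ / V₁) ^ (1 / (n₁ - n₂))) (1:ℝ),
      (1 - (1 + n₁) * φ₁) * slip V₁ n₁ φ₁ < V₁ * (1 - φ₁) ^ n₁ ∧
      V₁ * (1 - φ₁) ^ n₁ < slip V₂ n₂ φ₁ - φ₁ * slip V₁ n₁ φ₁ ∧
      V₁ * (1 - φ₁) ^ n₁ < V₂ ∧
      V₂ < V₁) ∧
    (V₁ * (1 - (1 - (V₂ / V₁) ^ (1 / (n₁ - n₂)))) ^ n₁ =
      slip V₂ n₂ (1 - (V₂ / V₁) ^ (1 / (n₁ - n₂)))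
        - (1 - (V₂ / V₁) ^ (1 / (n₁ - n₂)))
            * slip V₁ n₁ (1 - (V₂ / V₁) ^ (1 / (n₁ - n₂)))) := by
  have hV₁ : 0 < V₁ := hV2.trans hV
  have hd : 0 < n₁ - n₂ := sub_pos.2 hn
  have hr : 0 < V₂ / V₁ := div_pos hV2 hV₁
  set c := (V₂ / V₁) ^ (1 / (n₁ - n₂)) with hc
  have hc0 : 0 < c := Real.rpow_pos_of_pos hr _
  have hc1 : c < 1 :=
    Real.rpow_lt_one hr.le ((div_lt_one hV₁).2 hV) (one_div_pos.2 hd)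
  have hcV : V₁ * c ^ (n₁ - n₂) = V₂ := by
    rw [hc, ← Real.rpow_mul hr.le, one_div_mul_cancel hd.ne', Real.rpow_one,
      mul_div_cancel₀ _ hV₁.ne']
  constructor
  · rintro φ ⟨hφ, hφ1⟩
    have hs : 0 < 1 - φ := sub_pos.2 hφ1
    have hφ0 : 0 < φ := (sub_pos.2 hc1).trans hφ
    have hslip : 0 < slip V₁ n₁ φ := mul_pos hV₁ (Real.rpow_pos_of_pos hs _)
    have hlt : V₁ * (1 - φ) ^ (n₁ - n₂) < V₂ := by
      rw [← hcV]
      exact mul_lt_mul_of_pos_left (Real.rpow_lt_rpow hs.le (by linarith) hd) hV₁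
    have hslip_lt : slip V₁ n₁ φ < slip V₂ n₂ φ := by
      rw [slip_eq_mul_rpow hφ1 V₁ n₁ n₂]
      exact mul_lt_mul_of_pos_right hlt (Real.rpow_pos_of_pos hs _)
    have hslip₂ : slip V₂ n₂ φ < V₂ :=
      mul_lt_of_lt_one_right hV2 (Real.rpow_lt_one hs.le (by linarith) (by linarith))
    rw [mul_rpow_eq_one_sub_mul_slip hφ1]
    refine ⟨?_, ?_, ?_, hV⟩
    · exact mul_lt_mul_of_pos_right (by nlinarith) hslip
    · linarith
    · linarith [mul_pos hφ0 hslip]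
  · have hφ : 1 - c < 1 := sub_lt_self 1 hc0
    have heq : slip V₁ n₁ (1 - c) = slip V₂ n₂ (1 - c) := by
      rw [slip_eq_mul_rpow hφ V₁ n₁ n₂, slip, sub_sub_cancel, hcV]
    rw [mul_rpow_eq_one_sub_mul_slip hφ, heq]
    ring
end
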